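/- The family of subspaces (W_j)_{j ∈ {1,…,ℓ}^n}, indexed by all tuples j = (j_1,…,j_n) and given by W_j = W_{1,j_1} ∩ ⋯ ∩ W_{n,j_n}, is an independent family of subspaces of W, i.e. for every tuple j, W_j ∩ (Σ_{j'≠j} W_{j'}) = {0}. -/

import Mathlib

/-- If `t i` is an independent family of submodules for each `i`, then the family of
intersections `⨅ i, t i (j i)`, indexed by all choice functions `j`, is independent. -/
theorem iSupIndep_iInf_pi {R M ι : Type*} {β : ι → Type*} [Ring R] [AddCommGroup M] [Module R M]
    [Finite ι] {t : (i : ι) → β i → Submodule R M} (ht : ∀ i, iSupIndep (t i)) :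
    iSupIndep fun j : (i : ι) → β i => ⨅ i, t i (j i) := by
  classical
  have := Fintype.ofFinite ι
  rw [iSupIndep_iff_finsetSum_eq_zero_imp_eq_zero]
  intro s v hv hsum j hj
  have key (T : Finset ι) : ∑ k ∈ s with ∀ i ∈ T, k i = j i, v k = 0 := by
    induction T using Finset.induction_on with
    | empty => simpa using hsum
    | insert i T _ ih =>
      have h := (iSupIndep_iff_finsetSum_eq_zero_imp_eq_zero _).1 (ht i) (s.image fun k => k i)
        (fun a => ∑ k ∈ s with (∀ i ∈ T, k i = j i) ∧ k i = a, v k)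
        (fun a _ => Submodule.sum_mem _ fun k hk => by
          obtain ⟨hks, -, rfl⟩ := Finset.mem_filter.1 hk
          exact (Submodule.mem_iInf _).1 (hv k hks) i)
        (by
          rw [← ih, ← Finset.sum_fiberwise_of_maps_to (t := s.image fun k => k i)
            (g := fun k => k i)
            fun k hk => Finset.mem_image_of_mem _ (Finset.mem_filter.1 hk).1]
          simp only [Finset.filter_filter])
        (j i) (Finset.mem_image_of_mem _ hj)
      simpa only [Finset.forall_mem_insert, and_comm] using h
  have h := key Finset.univ
  have hs : {k ∈ s | ∀ i ∈ Finset.univ, k i = j i} = {j} := by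
    ext k
    simp only [Finset.mem_filter, Finset.mem_singleton]
    exact ⟨fun h => funext fun i => h.2 i (Finset.mem_univ i),
      fun h => ⟨h ▸ hj, fun i _ => congrFun h i⟩⟩
  rwa [hs, Finset.sum_singleton] at h


/-- The family of subspaces `(W_j)_{j ∈ {1,…,ℓ}ⁿ}` given by
`W_j = Wsub 1 j₁ ∩ ⋯ ∩ Wsub n jₙ` is an independent family of subspaces of `W`:
each `W_j` intersects the sum of all the others trivially. -/
theorem tuple_family_independent
    {C : Type*} [Field C] {W : Type*} [AddCommGroup W] [Module C W]
    [FiniteDimensional C W] (n ℓ : ℕ) (hn : 1 ≤ n) (hℓ : 1 ≤ ℓ)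
    (Wsub : Fin n → Fin ℓ → Submodule C W)
    (hind : ∀ (i : Fin n) (j : Fin ℓ), Wsub i j ⊓ (⨆ j' ≠ j, Wsub i j') = ⊥) :
    ∀ j : Fin n → Fin ℓ,
      (⨅ i, Wsub i (j i)) ⊓ (⨆ j' ≠ j, ⨅ i, Wsub i (j' i)) = ⊥ := by
  have h : iSupIndep fun j : Fin n → Fin ℓ => ⨅ i, Wsub i (j i) :=
    iSupIndep_iInf_pi fun i j => disjoint_iff.2 (hind i j)
  exact fun j => (h j).eq_bot
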